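/- (Proposition 2: existence for positive symmetric D.) For every ε ∈ [0,1] there exist a symmetric m×m real matrix D with all entries strictly positive and nonzero determinant, and differentiable functions F(·; ε), G : ℝ^m → ℝ with F(0; ε) = 0, G(0) = 0, and gradients (as row vectors) F′(y; ε) = f(y; ε)·D for all y ∈ ℝ^m and G′(x) = g(x)·D for all x ∈ ℝ^m; consequently the potential function U(x; ε) = g(x) D xᵀ − G(x) − F(g(x); ε) exists for the (d_v, d_c, m) nonbinary LDPC ensemble. -/

import Mathlib

open scoped BigOperators

noncomputable section

/-- Number of `j`-dimensional subspaces `U` of `𝔽₂^m` whose intersection with `W`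
has dimension `k`. -/
def numInter (m j k : ℕ) (W : Submodule (ZMod 2) (Fin m → ZMod 2)) : ℕ :=
  Set.ncard {U : Submodule (ZMod 2) (Fin m → ZMod 2) |
    Module.finrank (ZMod 2) U = j ∧ Module.finrank (ZMod 2) ↥(U ⊓ W) = k}

/-- Number of `j`-dimensional subspaces `U` of `𝔽₂^m` whose sum with `W`
has dimension `k`. -/
def numSum (m j k : ℕ) (W : Submodule (ZMod 2) (Fin m → ZMod 2)) : ℕ :=
  Set.ncard {U : Submodule (ZMod 2) (Fin m → ZMod 2) |
    Module.finrank (ZMod 2) U = j ∧ Module.finrank (ZMod 2) ↥(U ⊔ W) = k}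

/-- Number of `j`-dimensional subspaces of `𝔽₂^m`. -/
def numDim (m j : ℕ) : ℕ :=
  Set.ncard {U : Submodule (ZMod 2) (Fin m → ZMod 2) | Module.finrank (ZMod 2) U = j}

/-- A canonical `i`-dimensional subspace of `𝔽₂^m` (for `i ≤ m`): vectors supported on
the first `i` coordinates. -/
def stdW (m i : ℕ) : Submodule (ZMod 2) (Fin m → ZMod 2) :=
  Submodule.span (ZMod 2) {x | ∀ t : Fin m, i ≤ (t : ℕ) → x t = 0}

/-- `V^m_{i,j,k}`: probability that a uniformly random `j`-dimensional subspace `U`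
of `𝔽₂^m` satisfies `dim (U ⊓ W) = k`, for a fixed `i`-dimensional subspace `W`. -/
def Vprob (m i j k : ℕ) : ℝ := (numInter m j k (stdW m i) : ℝ) / (numDim m j : ℝ)

/-- `C^m_{i,j,k}`: probability that a uniformly random `j`-dimensional subspace `U`
of `𝔽₂^m` satisfies `dim (U ⊔ W) = k`, for a fixed `i`-dimensional subspace `W`. -/
def Cprob (m i j k : ℕ) : ℝ := (numSum m j k (stdW m i) : ℝ) / (numDim m j : ℝ)

/-- The operation `⊡`. -/
def boxdot (m : ℕ) (a b : Fin (m+1) → ℝ) : Fin (m+1) → ℝ :=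
  fun k => ∑ i : Fin (m+1), ∑ j : Fin (m+1), Vprob m i j k * a i * b j

/-- The operation `⊠`. -/
def boxtimes (m : ℕ) (a b : Fin (m+1) → ℝ) : Fin (m+1) → ℝ :=
  fun k => ∑ i : Fin (m+1), ∑ j : Fin (m+1), Cprob m i j k * a i * b j

/-- `boxdotPow m n a = ⊡^{n+1} a` (the `(n+1)`-fold `⊡`-product of `a` with itself). -/
def boxdotPow (m : ℕ) : ℕ → (Fin (m+1) → ℝ) → (Fin (m+1) → ℝ)
  | 0, a => a
  | n+1, a => boxdot m a (boxdotPow m n a)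

/-- `boxtimesPow m n a = ⊠^{n+1} a` (the `(n+1)`-fold `⊠`-product of `a` with itself). -/
def boxtimesPow (m : ℕ) : ℕ → (Fin (m+1) → ℝ) → (Fin (m+1) → ℝ)
  | 0, a => a
  | n+1, a => boxtimes m a (boxtimesPow m n a)

/-- `p∘(ε)`. -/
def pcirc (m : ℕ) (ε : ℝ) : Fin (m+1) → ℝ :=
  fun i => (m.choose i : ℝ) * ε ^ (i : ℕ) * (1 - ε) ^ (m - (i : ℕ))

/-- `f∘(y∘; ε) = p∘(ε) ⊡ (⊡^{d_v − 1} y∘)`. -/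
def fcirc (m dv : ℕ) (ε : ℝ) (y : Fin (m+1) → ℝ) : Fin (m+1) → ℝ :=
  boxdot m (pcirc m ε) (boxdotPow m (dv - 2) y)

/-- `g∘(x∘) = ⊠^{d_c − 1} x∘`. -/
def gcirc (m dc : ℕ) (x : Fin (m+1) → ℝ) : Fin (m+1) → ℝ :=
  boxtimesPow m (dc - 2) x

/-- Extension of `x ∈ ℝ^m` (indexed `1,…,m`) to `ℕ` with conventions `x_0 = 1`,
`x_i = 0` for `i > m`. -/
def extSeq (m : ℕ) (x : Fin m → ℝ) : ℕ → ℝ :=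
  fun i => if _h0 : i = 0 then 1 else if h : i ≤ m then x ⟨i - 1, by omega⟩ else 0

/-- `x̃ ∈ ℝ^{m+1}` with `x̃_i = x_i − x_{i+1}`. -/
def tilde (m : ℕ) (x : Fin m → ℝ) : Fin (m+1) → ℝ :=
  fun i => extSeq m x i - extSeq m x ((i : ℕ) + 1)

/-- `f(y; ε)_i = Σ_{k=i}^m f∘(ỹ; ε)_k` (here `i : Fin m` denotes the index `i+1 ∈ {1,…,m}`). -/
def fFun (m dv : ℕ) (ε : ℝ) (y : Fin m → ℝ) : Fin m → ℝ :=
  fun i => ∑ k : Fin (m+1), if (i : ℕ) + 1 ≤ (k : ℕ) then fcirc m dv ε (tilde m y) k else 0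

/-- `g(x)_i = Σ_{k=i}^m g∘(x̃)_k`. -/
def gFun (m dc : ℕ) (x : Fin m → ℝ) : Fin m → ℝ :=
  fun i => ∑ k : Fin (m+1), if (i : ℕ) + 1 ≤ (k : ℕ) then gcirc m dc (tilde m x) k else 0

/-- `p(ε)_i = Σ_{k=i}^m p∘_k(ε)`. -/
def pFun (m : ℕ) (ε : ℝ) : Fin m → ℝ :=
  fun i => ∑ k : Fin (m+1), if (i : ℕ) + 1 ≤ (k : ℕ) then pcirc m ε k else 0

/-- `X_ε = {x ∈ ℝ^m : 0 ≤ x_i ≤ p(ε)_i}`. -/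
def Xset (m : ℕ) (ε : ℝ) : Set (Fin m → ℝ) := {x | ∀ i, 0 ≤ x i ∧ x i ≤ pFun m ε i}

/-- `Y = [0,1]^m`. -/
def Yset (m : ℕ) : Set (Fin m → ℝ) := {y | ∀ i, 0 ≤ y i ∧ y i ≤ 1}

/-- The continuous linear map `v ↦ Σ_s c_s v_s`, i.e. the row vector `c` viewed as a
linear functional; used to express gradients. -/
def rowDeriv (m : ℕ) (c : Fin m → ℝ) : (Fin m → ℝ) →L[ℝ] ℝ :=
  ∑ s : Fin m, c s • (ContinuousLinearMap.proj s : (Fin m → ℝ) →L[ℝ] ℝ)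

/-- The potential function `U(x; ε) = g(x) D xᵀ − G(x) − F(g(x); ε)` (with `ε` fixed,
absorbed into `F`). -/
def Upot (m dc : ℕ) (D : Matrix (Fin m) (Fin m) ℝ) (F G : (Fin m → ℝ) → ℝ)
    (x : Fin m → ℝ) : ℝ :=
  (∑ a : Fin m, ∑ b : Fin m, gFun m dc x a * D a b * x b) - G x - F (gFun m dc x)

section SubspaceAverages

open Module

variable {m : ℕ}

local notation "V" => (Fin m → ZMod 2)
local notation "GLV" => ((Fin m → ZMod 2) ≃ₗ[ZMod 2] (Fin m → ZMod 2))
local notation "SubV" => Submodule (ZMod 2) (Fin m → ZMod 2)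

instance fintypeLinearEquiv (m : ℕ) :
    Fintype ((Fin m → ZMod 2) ≃ₗ[ZMod 2] (Fin m → ZMod 2)) :=
  have : Finite ((Fin m → ZMod 2) ≃ₗ[ZMod 2] (Fin m → ZMod 2)) := DFunLike.finite _
  Fintype.ofFinite _

instance fintypeSubmodule (m : ℕ) : Fintype (Submodule (ZMod 2) (Fin m → ZMod 2)) :=
  Fintype.ofFinite _

theorem mem_stdW {i : ℕ} {x : V} : x ∈ stdW m i ↔ ∀ t : Fin m, i ≤ (t : ℕ) → x t = 0 := by
  let S : SubV :=
    { carrier := {x | ∀ t : Fin m, i ≤ (t : ℕ) → x t = 0}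
      add_mem' := fun ha hb t ht => by simp [ha t ht, hb t ht]
      zero_mem' := fun t _ => rfl
      smul_mem' := fun c a ha t ht => by simp [ha t ht] }
  have h : stdW m i = S := Submodule.span_eq S
  rw [h]; rfl

theorem stdW_mono {i j : ℕ} (h : i ≤ j) : stdW m i ≤ stdW m j := fun _ hx =>
  mem_stdW.2 fun t ht => mem_stdW.1 hx t (h.trans ht)

theorem finrank_stdW {i : ℕ} (h : i ≤ m) : finrank (ZMod 2) (stdW m i) = i := by
  let e : stdW m i ≃ₗ[ZMod 2] (Fin i → ZMod 2) :=
    { toFun := fun x t => x.1 (Fin.castLE h t)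
      map_add' := fun _ _ => rfl
      map_smul' := fun _ _ => rfl
      invFun := fun y => ⟨fun t => if ht : (t : ℕ) < i then y ⟨t, ht⟩ else 0,
        mem_stdW.2 fun t ht => by simp [ht]⟩
      left_inv := fun x => by
        ext t
        by_cases ht : (t : ℕ) < i
        · simp [ht]
        · simp [ht, mem_stdW.1 x.2 t (not_lt.1 ht)]
      right_inv := fun y => by ext t; simp }
  rw [e.finrank_eq]; simp

theorem finrank_le_nat (T : SubV) : finrank (ZMod 2) T ≤ m := by
  simpa using Submodule.finrank_le T

/-- The image of a subspace under a linear automorphism of `𝔽₂^m`. -/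
abbrev imageSub (g : GLV) (T : SubV) : SubV := T.map (g : V →ₗ[ZMod 2] V)

theorem imageSub_mul (g h : GLV) (T : SubV) :
    imageSub (g * h) T = imageSub g (imageSub h T) :=
  Submodule.map_comp (h : V →ₗ[ZMod 2] V) (g : V →ₗ[ZMod 2] V) T

theorem imageSub_one (T : SubV) : imageSub 1 T = T := by
  ext x; simp [imageSub]

theorem imageSub_le_iff (g : GLV) (S T : SubV) :
    imageSub g S ≤ T ↔ S ≤ imageSub g⁻¹ T := by
  constructor
  · intro h
    have := Submodule.map_mono (f := ((g⁻¹ : GLV) : V →ₗ[ZMod 2] V)) h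
    change imageSub g⁻¹ (imageSub g S) ≤ _ at this
    rwa [← imageSub_mul, inv_mul_cancel, imageSub_one] at this
  · intro h
    have := Submodule.map_mono (f := (g : V →ₗ[ZMod 2] V)) h
    change _ ≤ imageSub g (imageSub g⁻¹ T) at this
    rwa [← imageSub_mul, mul_inv_cancel, imageSub_one] at this

theorem finrank_imageSub (g : GLV) (T : SubV) :
    finrank (ZMod 2) (imageSub g T) = finrank (ZMod 2) T :=
  LinearEquiv.finrank_map_eq g T

theorem exists_imageSub_stdW (T : SubV) :
    ∃ g : GLV, imageSub g (stdW m (finrank (ZMod 2) T)) = T := by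
  let e : stdW m (finrank (ZMod 2) T) ≃ₗ[ZMod 2] T :=
    LinearEquiv.ofFinrankEq _ _ (finrank_stdW (finrank_le_nat T))
  obtain ⟨g, hg⟩ := Submodule.exists_linearEquiv_restrict_eq e
  refine ⟨g, le_antisymm ?_ fun x hx => ?_⟩
  · rintro _ ⟨x, hx, rfl⟩
    have := hg ⟨x, hx⟩
    simp at this ⊢
    rw [← this]; exact (e ⟨x, hx⟩).2
  · refine ⟨e.symm ⟨x, hx⟩, (e.symm ⟨x, hx⟩).2, ?_⟩
    simp [← hg]

theorem expect_mul_right (h : GLV) (φ : GLV → ℝ) : 𝔼 g, φ (g * h) = 𝔼 g, φ g :=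
  Fintype.expect_equiv (Equiv.mulRight h) _ _ fun _ => rfl

theorem expect_mul_left (h : GLV) (φ : GLV → ℝ) : 𝔼 g, φ (h * g) = 𝔼 g, φ g :=
  Fintype.expect_equiv (Equiv.mulLeft h) _ _ fun _ => rfl

theorem expect_inv (φ : GLV → ℝ) : 𝔼 g, φ g⁻¹ = 𝔼 g, φ g :=
  Fintype.expect_equiv (Equiv.inv _) _ _ fun _ => rfl

theorem expect_imageSub (φ : SubV → ℝ) (T : SubV) :
    𝔼 g, φ (imageSub g T) = 𝔼 g, φ (imageSub g (stdW m (finrank (ZMod 2) T))) := by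
  obtain ⟨h, hh⟩ := exists_imageSub_stdW T
  conv_lhs => rw [← hh]
  simp_rw [← imageSub_mul]
  exact expect_mul_right h fun g => φ (imageSub g (stdW m (finrank (ZMod 2) T)))

open Classical in
/-- The finite set of `j`-dimensional subspaces of `𝔽₂^m`. -/
def subspacesOfDim (m j : ℕ) : Finset (Submodule (ZMod 2) (Fin m → ZMod 2)) :=
  Finset.univ.filter fun U => finrank (ZMod 2) U = j

theorem mem_subspacesOfDim {j : ℕ} {U : SubV} :
    U ∈ subspacesOfDim m j ↔ finrank (ZMod 2) U = j := by
  simp [subspacesOfDim]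

theorem card_subspacesOfDim (m j : ℕ) : (subspacesOfDim m j).card = numDim m j := by
  classical
  rw [numDim, Set.ncard_eq_toFinset_card', Set.toFinset_ofPred]
  congr

theorem sum_subspaces {j : ℕ} (φ : SubV → ℝ) :
    ∑ U ∈ subspacesOfDim m j, φ U =
      numDim m j * 𝔼 g, φ (imageSub g (stdW m j)) := by
  have key (h : GLV) : ∑ U ∈ subspacesOfDim m j, φ U =
      ∑ U ∈ subspacesOfDim m j, φ (imageSub h U) := by
    refine Finset.sum_bij' (fun U _ => imageSub h⁻¹ U) (fun U _ => imageSub h U) ?_ ?_ ?_ ?_ ?_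
    · intro U hU; simpa [mem_subspacesOfDim, finrank_imageSub] using hU
    · intro U hU; simpa [mem_subspacesOfDim, finrank_imageSub] using hU
    · intro U hU; rw [← imageSub_mul, mul_inv_cancel, imageSub_one]
    · intro U hU; rw [← imageSub_mul, inv_mul_cancel, imageSub_one]
    · intro U hU; rw [← imageSub_mul, mul_inv_cancel, imageSub_one]
  calc _ = 𝔼 h : GLV, ∑ U ∈ subspacesOfDim m j, φ (imageSub h U) := by
        simp_rw [← key]; rw [Fintype.expect_const]
    _ = ∑ U ∈ subspacesOfDim m j, 𝔼 h : GLV, φ (imageSub h U) :=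
        Finset.expect_sum_comm _ _ _
    _ = ∑ U ∈ subspacesOfDim m j, 𝔼 h : GLV, φ (imageSub h (stdW m j)) := by
        refine Finset.sum_congr rfl fun U hU => ?_
        rw [expect_imageSub, mem_subspacesOfDim.1 hU]
    _ = _ := by rw [Finset.sum_const, card_subspacesOfDim, nsmul_eq_mul]

theorem numDim_ne_zero {j : ℕ} (hj : j ≤ m) : (numDim m j : ℝ) ≠ 0 := by
  have : 0 < numDim m j := (Set.ncard_pos (Set.toFinite _)).2 ⟨stdW m j, finrank_stdW hj⟩
  positivity

theorem ncard_div_numDim {j : ℕ} (hj : j ≤ m) (P : SubV → Prop) [DecidablePred P] :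
    (Set.ncard {U : SubV | finrank (ZMod 2) U = j ∧ P U} : ℝ) / numDim m j =
      𝔼 g, if P (imageSub g (stdW m j)) then 1 else 0 := by
  rw [div_eq_iff (numDim_ne_zero hj), mul_comm, ← sum_subspaces fun U => if P U then 1 else 0,
    Finset.sum_boole, ← Set.ncard_coe_finset]
  congr
  ext U
  simp [mem_subspacesOfDim]

theorem sum_expect_indicator (d : GLV → ℕ) (hd : ∀ g, d g ≤ m) (q : ℕ → ℝ) :
    ∑ k : Fin (m + 1), (𝔼 g, if d g = k then (1 : ℝ) else 0) * q k = 𝔼 g, q (d g) := by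
  simp_rw [Finset.expect_mul]
  rw [← Finset.expect_sum_comm]
  refine Finset.expect_congr rfl fun g _ => ?_
  rw [Finset.sum_eq_single (⟨d g, Nat.lt_succ_of_le (hd g)⟩ : Fin (m + 1))]
  · simp
  · intro k _ hk
    rw [if_neg, zero_mul]
    rintro h
    exact hk (Fin.ext h.symm)
  · simp

theorem sum_Vprob_mul (i : ℕ) {j : ℕ} (hj : j ≤ m) (q : ℕ → ℝ) :
    ∑ k : Fin (m + 1), Vprob m i j k * q k =
      𝔼 g, q (finrank (ZMod 2) ↥(stdW m i ⊓ imageSub g (stdW m j))) := by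
  rw [← sum_expect_indicator _ fun g => finrank_le_nat _]
  refine Finset.sum_congr rfl fun k _ => ?_
  rw [Vprob, numInter, ncard_div_numDim hj fun U => finrank (ZMod 2) ↥(U ⊓ stdW m i) = k]
  congr 1
  exact Finset.expect_congr rfl fun g _ => by rw [inf_comm]

theorem sum_Cprob_mul (i : ℕ) {j : ℕ} (hj : j ≤ m) (q : ℕ → ℝ) :
    ∑ k : Fin (m + 1), Cprob m i j k * q k =
      𝔼 g, q (finrank (ZMod 2) ↥(stdW m i ⊔ imageSub g (stdW m j))) := by
  rw [← sum_expect_indicator _ fun g => finrank_le_nat _]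
  refine Finset.sum_congr rfl fun k _ => ?_
  rw [Cprob, numSum, ncard_div_numDim hj fun U => finrank (ZMod 2) ↥(U ⊔ stdW m i) = k]
  congr 1
  exact Finset.expect_congr rfl fun g _ => by rw [sup_comm]

open Classical in
/-- The probability that the standard `s`-dimensional subspace of `𝔽₂^m` is contained in a
uniformly random `k`-dimensional subspace. -/
def inclProb (m s k : ℕ) : ℝ :=
  𝔼 g : (Fin m → ZMod 2) ≃ₗ[ZMod 2] (Fin m → ZMod 2),
    if stdW m s ≤ imageSub g (stdW m k) then 1 else 0

open Classical in
theorem expect_le_imageSub (s : ℕ) (T : SubV) :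
    (𝔼 g : GLV, if stdW m s ≤ imageSub g T then (1 : ℝ) else 0) =
      inclProb m s (finrank (ZMod 2) T) :=
  expect_imageSub (fun U => if stdW m s ≤ U then (1 : ℝ) else 0) T

open Classical in
theorem expect_imageSub_le (T : SubV) (s : ℕ) :
    (𝔼 g : GLV, if imageSub g T ≤ stdW m s then (1 : ℝ) else 0) =
      inclProb m (finrank (ZMod 2) T) s := by
  rw [expect_imageSub (fun U => if U ≤ stdW m s then (1 : ℝ) else 0) T, inclProb]
  simp_rw [imageSub_le_iff]
  exact expect_inv fun g : GLV =>
    if stdW m (finrank (ZMod 2) T) ≤ imageSub g (stdW m s) then (1 : ℝ) else 0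

theorem imageSub_inf (g : GLV) (S T : SubV) :
    imageSub g (S ⊓ T) = imageSub g S ⊓ imageSub g T :=
  Submodule.map_inf _ g.injective

theorem sum_Vprob_mul_inclProb {i j s : ℕ} (hj : j ≤ m) :
    ∑ k : Fin (m + 1), Vprob m i j k * inclProb m s k = inclProb m s i * inclProb m s j := by
  classical
  rw [sum_Vprob_mul i hj]
  simp_rw [← expect_le_imageSub s, imageSub_inf, ← imageSub_mul, le_inf_iff, ite_and]
  rw [Finset.expect_comm]
  have (h : GLV) : (𝔼 g : GLV, if stdW m s ≤ imageSub h (stdW m i) then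
      if stdW m s ≤ imageSub (h * g) (stdW m j) then (1 : ℝ) else 0 else 0) =
      (if stdW m s ≤ imageSub h (stdW m i) then 1 else 0) * inclProb m s j := by
    split_ifs
    · rw [one_mul, inclProb]
      exact expect_mul_left h fun g => if stdW m s ≤ imageSub g (stdW m j) then (1 : ℝ) else 0
    · simp
  simp_rw [this, ← Finset.expect_mul]
  rfl

theorem sum_Cprob_mul_inclProb {i j s : ℕ} (hi : i ≤ m) (hj : j ≤ m) :
    ∑ k : Fin (m + 1), Cprob m i j k * inclProb m k s = inclProb m i s * inclProb m j s := by
  classical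
  rw [sum_Cprob_mul i hj fun k => inclProb m k s]
  simp_rw [← expect_imageSub_le, imageSub, Submodule.map_sup, ← imageSub_mul, sup_le_iff,
    ite_and]
  rw [Finset.expect_comm]
  have (h : GLV) : (𝔼 g : GLV, if imageSub h (stdW m i) ≤ stdW m s then
      if imageSub (h * g) (stdW m j) ≤ stdW m s then (1 : ℝ) else 0 else 0) =
      (if imageSub h (stdW m i) ≤ stdW m s then 1 else 0) * inclProb m j s := by
    split_ifs
    · rw [one_mul, expect_mul_left h fun g =>
        if imageSub g (stdW m j) ≤ stdW m s then (1 : ℝ) else 0, expect_imageSub_le,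
        finrank_stdW hj]
    · simp
  simp_rw [this, ← Finset.expect_mul]
  rw [expect_imageSub_le, finrank_stdW hi]

theorem sum_Vprob_add_sum_Cprob {i j : ℕ} (hi : i ≤ m) (hj : j ≤ m) :
    ∑ k : Fin (m + 1), Vprob m i j k * (k : ℕ) + ∑ k : Fin (m + 1), Cprob m i j k * (k : ℕ) =
      i + j := by
  rw [sum_Vprob_mul i hj fun k => (k : ℝ), sum_Cprob_mul i hj fun k => (k : ℝ),
    ← Finset.expect_add_distrib]
  rw [Finset.expect_congr rfl (g := fun _ => (i + j : ℝ)), Fintype.expect_const]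
  intro g _
  have := Submodule.finrank_sup_add_finrank_inf_eq (stdW m i) (imageSub g (stdW m j))
  rw [finrank_imageSub, finrank_stdW hi, finrank_stdW hj] at this
  rw [add_comm]
  exact_mod_cast this

/-- The number of linearly independent `s`-tuples in `𝔽₂^k`. -/
def numIndep (s k : ℕ) : ℝ := ∏ i ∈ Finset.range s, ((2 : ℝ) ^ k - 2 ^ i)

theorem numIndep_eq_zero {s k : ℕ} (h : k < s) : numIndep s k = 0 :=
  Finset.prod_eq_zero (Finset.mem_range.2 h) (sub_self _)

theorem numIndep_pos {s k : ℕ} (h : s ≤ k) : 0 < numIndep s k :=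
  Finset.prod_pos fun _ hi => sub_pos.2 <|
    pow_lt_pow_right₀ one_lt_two ((Finset.mem_range.1 hi).trans_le h)

theorem card_indep_mem {s : ℕ} (T : SubV) :
    (Nat.card {v : Fin s → V // LinearIndependent (ZMod 2) v ∧ ∀ i, v i ∈ T} : ℝ) =
      numIndep s (finrank (ZMod 2) T) := by
  let e : {v : Fin s → V // LinearIndependent (ZMod 2) v ∧ ∀ i, v i ∈ T} ≃
      {v : Fin s → T // LinearIndependent (ZMod 2) v} :=
    { toFun := fun v => ⟨fun i => ⟨v.1 i, v.2.2 i⟩,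
        LinearIndependent.of_comp T.subtype v.2.1⟩
      invFun := fun v => ⟨fun i => v.1 i,
        v.2.map' T.subtype (Submodule.ker_subtype T), fun i => (v.1 i).2⟩
      left_inv := fun _ => rfl
      right_inv := fun _ => rfl }
  rw [Nat.card_congr e]
  by_cases h : s ≤ finrank (ZMod 2) T
  · rw [card_linearIndependent h, numIndep, Nat.cast_prod, ← Fin.prod_univ_eq_prod_range
      fun i => (2 : ℝ) ^ finrank (ZMod 2) T - 2 ^ i]
    refine Finset.prod_congr rfl fun i _ => ?_
    rw [ZMod.card, Nat.cast_sub (Nat.pow_le_pow_right two_pos (i.2.le.trans h))]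
    push_cast
    rfl
  · rw [numIndep_eq_zero (not_le.1 h)]
    have : IsEmpty {v : Fin s → T // LinearIndependent (ZMod 2) v} :=
      ⟨fun v => h (by simpa using v.2.fintype_card_le_finrank)⟩
    simp

theorem inclProb_mul_numIndep {s k : ℕ} (hk : k ≤ m) :
    inclProb m s k * numIndep s m = numIndep s k := by
  classical
  let I := {v : Fin s → V // LinearIndependent (ZMod 2) v}
  have : Fintype I := Fintype.ofFinite _
  have hI : (Fintype.card I : ℝ) = numIndep s m := by
    have := card_indep_mem (s := s) (⊤ : SubV)
    rw [finrank_top] at this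
    simp at this
    rw [← this, ← Nat.card_eq_fintype_card]
  have h1 (v : I) : inclProb m s k =
      𝔼 g : GLV, if ∀ i, g (v.1 i) ∈ stdW m k then (1 : ℝ) else 0 := by
    have hr : finrank (ZMod 2) (Submodule.span (ZMod 2) (Set.range v.1)) = s := by
      simpa using finrank_span_eq_card v.2
    conv_lhs => rw [← hr, ← expect_imageSub_le]
    refine Finset.expect_congr rfl fun g _ => ?_
    congr 1
    simp [imageSub, Submodule.map_span_le]
  have h2 (g : GLV) : ∑ v : I, (if ∀ i, g (v.1 i) ∈ stdW m k then (1 : ℝ) else 0) =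
      numIndep s k := by
    have := card_indep_mem (s := s) (stdW m k)
    rw [finrank_stdW hk] at this
    rw [← this, Finset.sum_boole, ← Fintype.card_subtype, ← Nat.card_eq_fintype_card]
    congr 1
    refine Nat.card_congr
      { toFun := fun v => ⟨fun i => g (v.1.1 i), v.1.2.map' (g : V →ₗ[ZMod 2] V) g.ker, v.2⟩
        invFun := fun v => ⟨⟨fun i => g.symm (v.1 i),
          v.2.1.map' (g.symm : V →ₗ[ZMod 2] V) g.symm.ker⟩, fun i => by simpa using v.2.2 i⟩
        left_inv := fun v => by simp
        right_inv := fun v => by simp }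
  calc _ = ∑ v : I, inclProb m s k := by
        rw [Finset.sum_const, nsmul_eq_mul, Finset.card_univ, hI, mul_comm]
    _ = ∑ v : I, 𝔼 g : GLV, if ∀ i, g (v.1 i) ∈ stdW m k then (1 : ℝ) else 0 :=
        Finset.sum_congr rfl fun v _ => h1 v
    _ = _ := by
        rw [← Finset.expect_sum_comm]
        simp_rw [h2]
        rw [Fintype.expect_const]

theorem inclProb_eq_zero {s k : ℕ} (h : k < s) (hs : s ≤ m) : inclProb m s k = 0 := by
  have := inclProb_mul_numIndep (s := s) (h.le.trans hs)
  rw [numIndep_eq_zero h] at this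
  exact (mul_eq_zero.1 this).resolve_right (numIndep_pos hs).ne'

theorem inclProb_self_ne_zero {s : ℕ} (hs : s ≤ m) : inclProb m s s ≠ 0 := fun h => by
  have := inclProb_mul_numIndep (s := s) hs
  rw [h, zero_mul] at this
  exact (numIndep_pos le_rfl).ne this

theorem inclProb_zero_left {k : ℕ} (hk : k ≤ m) : inclProb m 0 k = 1 := by
  simpa [numIndep] using inclProb_mul_numIndep (s := 0) hk

theorem inclProb_top {k : ℕ} (hk : k ≤ m) : inclProb m k m = 1 := by
  have := inclProb_mul_numIndep (s := k) (le_refl m)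
  exact (mul_eq_right₀ (numIndep_pos hk).ne').1 this

theorem finrank_inf_supermodular {A A' B B' : SubV} (hA : A' ≤ A) (hB : B' ≤ B) :
    finrank (ZMod 2) ↥(A ⊓ B') + finrank (ZMod 2) ↥(A' ⊓ B) =
      finrank (ZMod 2) ↥(A ⊓ B' ⊔ A' ⊓ B) + finrank (ZMod 2) ↥(A' ⊓ B') := by
  rw [← Submodule.finrank_sup_add_finrank_inf_eq (A ⊓ B') (A' ⊓ B)]
  rw [show A ⊓ B' ⊓ (A' ⊓ B) = A' ⊓ B' from le_antisymm (fun x hx => ⟨hx.2.1, hx.1.2⟩)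
    fun x hx => ⟨⟨hA hx.1, hx.2⟩, hx.1, hB hx.2⟩]

theorem finrank_mixed_difference_pos {a b : ℕ} (ha : a < m) (hb : b < m) :
    0 < ∑ k : Fin (m + 1), Vprob m (a + 1) (b + 1) k * (k : ℕ) -
      ∑ k : Fin (m + 1), Vprob m a (b + 1) k * (k : ℕ) -
      ∑ k : Fin (m + 1), Vprob m (a + 1) b k * (k : ℕ) +
      ∑ k : Fin (m + 1), Vprob m a b k * (k : ℕ) := by
  rw [sum_Vprob_mul _ (by omega) fun k => (k : ℝ), sum_Vprob_mul _ (by omega) fun k => (k : ℝ),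
    sum_Vprob_mul _ (by omega) fun k => (k : ℝ), sum_Vprob_mul _ (by omega) fun k => (k : ℝ),
    ← Finset.expect_sub_distrib, ← Finset.expect_sub_distrib, ← Finset.expect_add_distrib]
  have hle (g : GLV) : stdW m (a + 1) ⊓ imageSub g (stdW m b) ⊔
      stdW m a ⊓ imageSub g (stdW m (b + 1)) ≤
      stdW m (a + 1) ⊓ imageSub g (stdW m (b + 1)) :=
    sup_le (inf_le_inf_left _ (Submodule.map_mono (stdW_mono b.le_succ)))
      (inf_le_inf_right _ (stdW_mono a.le_succ))
  have hmod (g : GLV) := finrank_inf_supermodular (stdW_mono (m := m) a.le_succ)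
    (Submodule.map_mono (f := (g : V →ₗ[ZMod 2] V)) (stdW_mono (m := m) b.le_succ))
  refine Finset.expect_pos' (fun g _ => ?_) ⟨LinearEquiv.funCongrLeft (ZMod 2) (ZMod 2)
    (Equiv.swap (⟨a, ha⟩ : Fin m) ⟨b, hb⟩), Finset.mem_univ _, ?_⟩
  · have h1 := Submodule.finrank_mono (hle g)
    have h2 := hmod g
    have : finrank (ZMod 2) ↥(stdW m (a + 1) ⊓ imageSub g (stdW m b)) +
      finrank (ZMod 2) ↥(stdW m a ⊓ imageSub g (stdW m (b + 1))) ≤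
      finrank (ZMod 2) ↥(stdW m (a + 1) ⊓ imageSub g (stdW m (b + 1))) +
      finrank (ZMod 2) ↥(stdW m a ⊓ imageSub g (stdW m b)) := by
      rw [h2]; gcongr
    have : (_ : ℝ) ≤ _ := Nat.cast_le.2 this
    push_cast at this
    linarith
  · set g : GLV := LinearEquiv.funCongrLeft (ZMod 2) (ZMod 2)
      (Equiv.swap (⟨a, ha⟩ : Fin m) ⟨b, hb⟩) with hg
    have hlt : stdW m (a + 1) ⊓ imageSub g (stdW m b) ⊔
        stdW m a ⊓ imageSub g (stdW m (b + 1)) <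
        stdW m (a + 1) ⊓ imageSub g (stdW m (b + 1)) := by
      refine (hle g).lt_of_not_ge fun hge => ?_
      have hker : stdW m (a + 1) ⊓ imageSub g (stdW m b) ⊔
          stdW m a ⊓ imageSub g (stdW m (b + 1)) ≤
          LinearMap.ker (LinearMap.proj (R := ZMod 2) (φ := fun _ : Fin m => ZMod 2) ⟨a, ha⟩) := by
        refine sup_le ?_ ?_
        · rintro _ ⟨_, x, hx, rfl⟩
          simpa [hg, LinearEquiv.funCongrLeft_apply, LinearMap.funLeft_apply] using
            mem_stdW.1 hx ⟨b, hb⟩ le_rfl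
        · intro x hx
          exact mem_stdW.1 hx.1 ⟨a, ha⟩ le_rfl
      have hmem : (Pi.single ⟨a, ha⟩ 1 : V) ∈
          stdW m (a + 1) ⊓ imageSub g (stdW m (b + 1)) := by
        refine ⟨mem_stdW.2 fun t ht => ?_, Pi.single ⟨b, hb⟩ 1, mem_stdW.2 fun t ht => ?_, ?_⟩
        · rw [Pi.single_eq_of_ne]; rintro rfl; simp at ht
        · rw [Pi.single_eq_of_ne]; rintro rfl; simp at ht
        · ext t
          have : Equiv.swap (⟨a, ha⟩ : Fin m) ⟨b, hb⟩ t = ⟨b, hb⟩ ↔ t = ⟨a, ha⟩ := by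
            rw [Equiv.swap_apply_eq_iff, Equiv.swap_apply_right]
          simp [hg, LinearEquiv.funCongrLeft_apply, LinearMap.funLeft_apply, Pi.single_apply, this]
      have := hker (hge hmem)
      simp at this
    have h1 := Submodule.finrank_lt_finrank_of_lt hlt
    have h2 := hmod g
    have : finrank (ZMod 2) ↥(stdW m (a + 1) ⊓ imageSub g (stdW m b)) +
      finrank (ZMod 2) ↥(stdW m a ⊓ imageSub g (stdW m (b + 1))) <
      finrank (ZMod 2) ↥(stdW m (a + 1) ⊓ imageSub g (stdW m (b + 1))) +
      finrank (ZMod 2) ↥(stdW m a ⊓ imageSub g (stdW m b)) := by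
      rw [h2]; gcongr
    have : (_ : ℝ) < _ := Nat.cast_lt.2 this
    push_cast at this
    linarith

end SubspaceAverages

section Potential

open scoped Matrix

variable {m : ℕ}

theorem numIndep_succ (s k : ℕ) : numIndep (s + 1) k = numIndep s k * (2 ^ k - 2 ^ s) :=
  Finset.prod_range_succ _ _

theorem numIndep_succ_succ (s k : ℕ) :
    numIndep (s + 1) (k + 1) = (2 ^ (k + 1) - 1) * 2 ^ s * numIndep s k := by
  induction s with
  | zero => simp [numIndep]
  | succ s ih => rw [numIndep_succ, ih, numIndep_succ s k]; ring

/-- Coefficients of the expansion `k = ∑ s, dimCoeff s * numIndep (s + 1) k`. -/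
def dimCoeff : ℕ → ℝ
  | 0 => 1
  | s + 1 => -dimCoeff s * (2 ^ (s + 1) - 1) / ((2 ^ (s + 2) - 1) * 2 ^ (s + 1))

theorem two_pow_succ_sub_one_ne_zero (s : ℕ) : (2 : ℝ) ^ (s + 1) - 1 ≠ 0 :=
  (sub_pos.2 (one_lt_pow₀ one_lt_two s.succ_ne_zero)).ne'

theorem dimCoeff_ne_zero (s : ℕ) : dimCoeff s ≠ 0 := by
  induction s with
  | zero => simp [dimCoeff]
  | succ s ih =>
    have h1 := two_pow_succ_sub_one_ne_zero s
    have h2 := two_pow_succ_sub_one_ne_zero (s + 1)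
    rw [dimCoeff]
    exact div_ne_zero (mul_ne_zero (neg_ne_zero.2 ih) h1)
      (mul_ne_zero h2 (pow_ne_zero _ two_ne_zero))

theorem sum_dimCoeff_mul_sub (n k : ℕ) :
    ∑ s ∈ Finset.range n, dimCoeff s * (numIndep (s + 1) (k + 1) - numIndep (s + 1) k) =
      1 - dimCoeff n * (2 ^ (n + 1) - 1) * 2 ^ n * numIndep n k := by
  induction n with
  | zero => norm_num [dimCoeff, numIndep]
  | succ n ih =>
    have h2 := two_pow_succ_sub_one_ne_zero (n + 1)
    rw [Finset.sum_range_succ, ih, numIndep_succ_succ, numIndep_succ, dimCoeff]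
    field_simp
    ring

theorem sum_dimCoeff_mul_numIndep {k : ℕ} (hk : k ≤ m) :
    ∑ s ∈ Finset.range m, dimCoeff s * numIndep (s + 1) k = k := by
  induction k with
  | zero =>
    rw [Nat.cast_zero]
    exact Finset.sum_eq_zero fun s _ => by rw [numIndep_eq_zero s.succ_pos, mul_zero]
  | succ k ih =>
    have h := sum_dimCoeff_mul_sub m k
    simp_rw [mul_sub] at h
    rw [Finset.sum_sub_distrib, ih (by omega), numIndep_eq_zero (by omega : k < m)] at h
    push_cast
    linarith

theorem exists_dim_eq_sum_inclProb (m : ℕ) : ∃ w : Fin m → ℝ, (∀ s, w s ≠ 0) ∧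
    ∀ k ≤ m, ∑ s : Fin m, w s * inclProb m (s + 1) k = k := by
  refine ⟨fun s => dimCoeff s * numIndep (s + 1) m,
    fun s => mul_ne_zero (dimCoeff_ne_zero _) (numIndep_pos s.2).ne', fun k hk => ?_⟩
  rw [← sum_dimCoeff_mul_numIndep hk,
    ← Fin.sum_univ_eq_sum_range fun s => dimCoeff s * numIndep (s + 1) k]
  refine Finset.sum_congr rfl fun s _ => ?_
  rw [← inclProb_mul_numIndep hk]
  ring

theorem exists_dim_eq_sum_inclProb_left (m : ℕ) : ∃ v : Fin (m + 1) → ℝ,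
    ∀ k ≤ m, ∑ s : Fin (m + 1), inclProb m k s * v s = k := by
  let Q : Matrix (Fin (m + 1)) (Fin (m + 1)) ℝ := Matrix.of fun k s => inclProb m k s
  have hQ : IsUnit Q.det := by
    rw [Matrix.det_of_isUpperTriangular
      (show Q.IsUpperTriangular from fun i j hij => inclProb_eq_zero hij (by omega))]
    exact (Finset.prod_ne_zero_iff.2 fun s _ => inclProb_self_ne_zero (by omega)).isUnit
  refine ⟨Q⁻¹ *ᵥ fun k : Fin (m + 1) => ((k : ℕ) : ℝ), fun k hk => ?_⟩
  have h : Q *ᵥ (Q⁻¹ *ᵥ fun k : Fin (m + 1) => ((k : ℕ) : ℝ)) = fun k : Fin (m + 1) => ((k : ℕ) : ℝ) := by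
    rw [Matrix.mulVec_mulVec, Matrix.mul_nonsing_inv _ hQ, Matrix.one_mulVec]
  exact congrFun h ⟨k, Nat.lt_succ_of_le hk⟩

theorem sum_bilinear_mul {n : ℕ} (P : Fin n → Fin n → Fin n → ℝ) (q : Fin n → ℝ)
    (h : ∀ i j, ∑ k, P i j k * q k = q i * q j) (a b : Fin n → ℝ) :
    ∑ k, (∑ i, ∑ j, P i j k * a i * b j) * q k = (∑ i, a i * q i) * ∑ j, b j * q j := by
  rw [Finset.sum_mul_sum]
  simp_rw [Finset.sum_mul]
  rw [Finset.sum_comm]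
  refine Finset.sum_congr rfl fun i _ => ?_
  rw [Finset.sum_comm]
  refine Finset.sum_congr rfl fun j _ => ?_
  calc _ = (∑ k, P i j k * q k) * (a i * b j) := by
        rw [Finset.sum_mul]; exact Finset.sum_congr rfl fun k _ => by ring
    _ = _ := by rw [h]; ring

theorem sum_boxdot_mul (s : ℕ) (a b : Fin (m + 1) → ℝ) :
    ∑ k, boxdot m a b k * inclProb m s k =
      (∑ k, a k * inclProb m s k) * ∑ k, b k * inclProb m s k :=
  sum_bilinear_mul (fun i j k => Vprob m i j k) (fun k => inclProb m s k)
    (fun i j => sum_Vprob_mul_inclProb (by omega)) a b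

theorem sum_boxtimes_mul (s : ℕ) (a b : Fin (m + 1) → ℝ) :
    ∑ k, boxtimes m a b k * inclProb m k s =
      (∑ k, a k * inclProb m k s) * ∑ k, b k * inclProb m k s :=
  sum_bilinear_mul (fun i j k => Cprob m i j k) (fun k => inclProb m k s)
    (fun i j => sum_Cprob_mul_inclProb (by omega) (by omega)) a b

theorem sum_boxdotPow_mul (s n : ℕ) (a : Fin (m + 1) → ℝ) :
    ∑ k, boxdotPow m n a k * inclProb m s k = (∑ k, a k * inclProb m s k) ^ (n + 1) := by
  induction n with
  | zero => simp [boxdotPow]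
  | succ n ih => rw [boxdotPow, sum_boxdot_mul, ih, ← pow_succ']

theorem sum_boxtimesPow_mul (s n : ℕ) (a : Fin (m + 1) → ℝ) :
    ∑ k, boxtimesPow m n a k * inclProb m k s = (∑ k, a k * inclProb m k s) ^ (n + 1) := by
  induction n with
  | zero => simp [boxtimesPow]
  | succ n ih => rw [boxtimesPow, sum_boxtimes_mul, ih, ← pow_succ']

theorem sum_boxtimesPow (n : ℕ) (a : Fin (m + 1) → ℝ) :
    ∑ k, boxtimesPow m n a k = (∑ k, a k) ^ (n + 1) := by
  have h (k : Fin (m + 1)) : inclProb m k m = 1 := inclProb_top (by omega)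
  simpa [h] using sum_boxtimesPow_mul m n a

theorem sum_range_ite_sub (q : ℕ → ℝ) (k n : ℕ) :
    ∑ i ∈ Finset.range n, (if i + 1 ≤ k then q (i + 1) - q i else 0) = q (min n k) - q 0 := by
  induction n with
  | zero => simp
  | succ n ih =>
    rw [Finset.sum_range_succ, ih]
    split_ifs with h
    · rw [min_eq_left h, min_eq_left (by omega)]; ring
    · rw [min_eq_right (by omega), min_eq_right (by omega), add_zero]

theorem sum_range_ite_sub_succ (u : ℕ → ℝ) {j n : ℕ} (h : j ≤ n) :
    ∑ k ∈ Finset.range n, (if j ≤ k then u k - u (k + 1) else 0) = u j - u n := by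
  induction n, h using Nat.le_induction with
  | base =>
    rw [sub_self]
    exact Finset.sum_eq_zero fun k hk => if_neg (not_le.2 (Finset.mem_range.1 hk))
  | succ n hn ih => rw [Finset.sum_range_succ, ih, if_pos hn]; ring

theorem sum_mul_eq_tail_sum (a : Fin (m + 1) → ℝ) (q : ℕ → ℝ) :
    ∑ k, a k * q k = q 0 * ∑ k, a k + ∑ i : Fin m, (q (i + 1) - q i) *
      ∑ k : Fin (m + 1), if (i : ℕ) + 1 ≤ (k : ℕ) then a k else 0 := by
  have h (k : Fin (m + 1)) :
      ∑ i : Fin m, (if (i : ℕ) + 1 ≤ (k : ℕ) then q (i + 1) - q i else 0) = q k - q 0 := by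
    rw [Fin.sum_univ_eq_sum_range fun i => if i + 1 ≤ (k : ℕ) then q (i + 1) - q i else 0,
      sum_range_ite_sub, min_eq_right (by omega)]
  simp_rw [Finset.mul_sum]
  rw [Finset.sum_comm, ← Finset.sum_add_distrib]
  refine Finset.sum_congr rfl fun k _ => ?_
  have : ∑ i : Fin m, (q (i + 1) - q i) * (if (i : ℕ) + 1 ≤ (k : ℕ) then a k else 0) =
      (q k - q 0) * a k := by
    rw [← h, Finset.sum_mul]
    refine Finset.sum_congr rfl fun i _ => ?_
    split_ifs <;> simp
  rw [this]
  ring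

theorem tail_sum_tilde (x : Fin m → ℝ) (i : Fin m) :
    ∑ k : Fin (m + 1), (if (i : ℕ) + 1 ≤ (k : ℕ) then tilde m x k else 0) = x i := by
  have h := sum_range_ite_sub_succ (extSeq m x) (show (i : ℕ) + 1 ≤ m + 1 by omega)
  rw [← Fin.sum_univ_eq_sum_range
    fun k => if (i : ℕ) + 1 ≤ k then extSeq m x k - extSeq m x (k + 1) else 0] at h
  exact h.trans (by simp [extSeq])

theorem sum_tilde (x : Fin m → ℝ) : ∑ k, tilde m x k = 1 := by
  have h := sum_range_ite_sub_succ (extSeq m x) (Nat.zero_le (m + 1))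
  rw [← Fin.sum_univ_eq_sum_range
    fun k => if 0 ≤ k then extSeq m x k - extSeq m x (k + 1) else 0] at h
  simpa [extSeq, tilde] using h

theorem sum_tilde_mul (x : Fin m → ℝ) (q : ℕ → ℝ) :
    ∑ k, tilde m x k * q k = q 0 + ∑ i : Fin m, (q (i + 1) - q i) * x i := by
  rw [sum_mul_eq_tail_sum, sum_tilde, mul_one]
  simp_rw [tail_sum_tilde]

theorem sum_mul_fFun (dv : ℕ) (ε : ℝ) (s : Fin m) (y : Fin m → ℝ) :
    ∑ a : Fin m, (inclProb m (s + 1) (a + 1) - inclProb m (s + 1) a) * fFun m dv ε y a =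
      (∑ k, pcirc m ε k * inclProb m (s + 1) k) *
        (∑ a : Fin m, (inclProb m (s + 1) (a + 1) - inclProb m (s + 1) a) * y a) ^
          (dv - 2 + 1) := by
  have h0 : inclProb m (s + 1) 0 = 0 := inclProb_eq_zero (Nat.succ_pos _) s.2
  have h1 := sum_mul_eq_tail_sum (fcirc m dv ε (tilde m y)) (inclProb m (s + 1))
  have h2 := sum_tilde_mul y (inclProb m (s + 1))
  rw [h0, zero_mul, zero_add] at h1
  rw [h0, zero_add] at h2
  rw [← h2, ← sum_boxdotPow_mul, ← sum_boxdot_mul]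
  exact h1.symm

theorem sum_mul_gFun (dc : ℕ) (s : Fin (m + 1)) (x : Fin m → ℝ) :
    ∑ a : Fin m, (inclProb m (a + 1) s - inclProb m a s) * gFun m dc x a =
      (1 + ∑ a : Fin m, (inclProb m (a + 1) s - inclProb m a s) * x a) ^ (dc - 2 + 1) - 1 := by
  have h0 : inclProb m 0 s = 1 := inclProb_zero_left (by omega)
  have h1 := sum_mul_eq_tail_sum (gcirc m dc (tilde m x)) fun k => inclProb m k s
  have h2 := sum_tilde_mul x fun k => inclProb m k s
  rw [h0, gcirc, sum_boxtimesPow, sum_tilde, one_pow, one_mul, sum_boxtimesPow_mul, h2, h0] at h1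
  exact eq_sub_of_add_eq' h1.symm

theorem rowDeriv_apply (c v : Fin m → ℝ) : rowDeriv m c v = ∑ s, c s * v s := by
  simp [rowDeriv]

theorem exists_potential {ι : Type*} [Fintype ι] {D : Matrix (Fin m) (Fin m) ℝ} (u : ι → ℝ)
    (L : ι → Fin m → ℝ) (hD : ∀ a b, D a b = ∑ s, u s * L s a * L s b) (φ Φ : ι → ℝ → ℝ)
    (hΦ : ∀ s t, HasDerivAt (Φ s) (φ s t) t) (h : (Fin m → ℝ) → Fin m → ℝ)
    (hh : ∀ s x, ∑ a, L s a * h x a = φ s (∑ a, L s a * x a)) :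
    ∃ F : (Fin m → ℝ) → ℝ, F 0 = 0 ∧
      ∀ x, HasFDerivAt F (rowDeriv m fun b => ∑ a, h x a * D a b) x := by
  refine ⟨fun x => ∑ s, u s * (Φ s (rowDeriv m (L s) x) - Φ s 0), by simp, fun x => ?_⟩
  have key := HasFDerivAt.fun_sum (u := Finset.univ) fun s _ =>
    ((((hΦ s (rowDeriv m (L s) x)).comp_hasFDerivAt x
      (rowDeriv m (L s)).hasFDerivAt).sub_const (Φ s 0)).const_mul (u s))
  refine key.congr_fderiv ?_
  ext v
  simp only [sum_apply, smul_apply, smul_eq_mul,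
    rowDeriv_apply, ← hh, hD, Finset.mul_sum, Finset.sum_mul]
  rw [Finset.sum_comm]
  refine Finset.sum_congr rfl fun b _ => ?_
  rw [Finset.sum_comm]
  exact Finset.sum_congr rfl fun a _ => Finset.sum_congr rfl fun s _ => by ring

end Potential

/-- **Proposition 2: existence for positive symmetric `D`.** There exist a
symmetric matrix `D` with all entries strictly positive and nonzero determinant, and
functions `F(·; ε), G` with `F(0; ε) = G(0) = 0` and gradients `f(·; ε)·D` and `g(·)·D`;
hence the potential function exists for the `(d_v, d_c, m)` nonbinary LDPC ensemble. -/
theorem exists_D_F_G (m dv dc : ℕ) (hm : 1 ≤ m) (hdv : 2 ≤ dv) (hdc : 2 ≤ dc)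
    (ε : ℝ) (hε : ε ∈ Set.Icc (0:ℝ) 1) :
    ∃ (D : Matrix (Fin m) (Fin m) ℝ) (F G : (Fin m → ℝ) → ℝ),
      D.IsSymm ∧ (∀ a b, 0 < D a b) ∧ D.det ≠ 0 ∧
      F 0 = 0 ∧ G 0 = 0 ∧
      (∀ y : Fin m → ℝ,
        HasFDerivAt F (rowDeriv m (fun s => ∑ j : Fin m, fFun m dv ε y j * D j s)) y) ∧
      (∀ x : Fin m → ℝ,
        HasFDerivAt G (rowDeriv m (fun s => ∑ j : Fin m, gFun m dc x j * D j s)) x) := by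
  obtain ⟨w, hw, hdim⟩ := exists_dim_eq_sum_inclProb m
  obtain ⟨v, hdim'⟩ := exists_dim_eq_sum_inclProb_left m
  let B : Matrix (Fin m) (Fin m) ℝ :=
    Matrix.of fun s a => inclProb m (s + 1) (a + 1) - inclProb m (s + 1) a
  let D : Matrix (Fin m) (Fin m) ℝ := B.transpose * Matrix.diagonal w * B
  have hD (a b : Fin m) : D a b = ∑ s, w s * B s a * B s b := by
    change (B.transpose * Matrix.diagonal w * B) a b = _
    rw [Matrix.mul_apply]
    simp only [Matrix.mul_diagonal, Matrix.transpose_apply]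
    exact Finset.sum_congr rfl fun s _ => by ring
  have hinter (i j : ℕ) (hj : j ≤ m) :
      ∑ k : Fin (m + 1), Vprob m i j k * (k : ℕ) =
        ∑ s : Fin m, w s * (inclProb m (s + 1) i * inclProb m (s + 1) j) := by
    simp_rw [← sum_Vprob_mul_inclProb hj, Finset.mul_sum]
    rw [Finset.sum_comm]
    refine Finset.sum_congr rfl fun k _ => ?_
    rw [← hdim k (by omega), Finset.mul_sum]
    exact Finset.sum_congr rfl fun s _ => by ring
  have hsum (i j : ℕ) (hi : i ≤ m) (hj : j ≤ m) :
      ∑ k : Fin (m + 1), Cprob m i j k * (k : ℕ) =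
        ∑ s : Fin (m + 1), v s * (inclProb m i s * inclProb m j s) := by
    simp_rw [← sum_Cprob_mul_inclProb hi hj, Finset.mul_sum]
    rw [Finset.sum_comm]
    refine Finset.sum_congr rfl fun k _ => ?_
    rw [← hdim' k (by omega), Finset.mul_sum]
    exact Finset.sum_congr rfl fun s _ => by ring
  have hDV (a b : Fin m) : D a b =
      ∑ k : Fin (m + 1), Vprob m (a + 1) (b + 1) k * (k : ℕ) -
      ∑ k : Fin (m + 1), Vprob m a (b + 1) k * (k : ℕ) -
      ∑ k : Fin (m + 1), Vprob m (a + 1) b k * (k : ℕ) +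
      ∑ k : Fin (m + 1), Vprob m a b k * (k : ℕ) := by
    rw [hinter _ _ (by omega), hinter _ _ (by omega),
      hinter _ _ (by omega), hinter _ _ (by omega),
      ← Finset.sum_sub_distrib, ← Finset.sum_sub_distrib, ← Finset.sum_add_distrib, hD]
    refine Finset.sum_congr rfl fun s _ => ?_
    simp only [B, Matrix.of_apply]
    ring
  have hDC (a b : Fin m) : D a b = ∑ s : Fin (m + 1), -v s *
      (inclProb m (a + 1) s - inclProb m a s) * (inclProb m (b + 1) s - inclProb m b s) := by
    have h11 := sum_Vprob_add_sum_Cprob (m := m) (i := a + 1) (j := b + 1) (by omega) (by omega)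
    have h01 := sum_Vprob_add_sum_Cprob (m := m) (i := a) (j := b + 1) (by omega) (by omega)
    have h10 := sum_Vprob_add_sum_Cprob (m := m) (i := a + 1) (j := b) (by omega) (by omega)
    have h00 := sum_Vprob_add_sum_Cprob (m := m) (i := a) (j := b) (by omega) (by omega)
    rw [hsum _ _ (by omega) (by omega)] at h11 h01 h10 h00
    rw [hDV, eq_sub_of_add_eq h11, eq_sub_of_add_eq h01, eq_sub_of_add_eq h10,
      eq_sub_of_add_eq h00]
    have : ∑ s : Fin (m + 1), -v s *
        (inclProb m (a + 1) s - inclProb m a s) * (inclProb m (b + 1) s - inclProb m b s) =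
        -∑ s, v s * (inclProb m (a + 1) s * inclProb m (b + 1) s) +
        ∑ s, v s * (inclProb m a s * inclProb m (b + 1) s) +
        ∑ s, v s * (inclProb m (a + 1) s * inclProb m b s) -
        ∑ s, v s * (inclProb m a s * inclProb m b s) := by
      rw [← Finset.sum_neg_distrib, ← Finset.sum_add_distrib, ← Finset.sum_add_distrib,
        ← Finset.sum_sub_distrib]
      exact Finset.sum_congr rfl fun s _ => by ring
    rw [this]
    ring
  have hB : B.det ≠ 0 := by
    have htri : B.IsUpperTriangular := fun i j (hij : j < i) => by
      have : (j : ℕ) < i := hij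
      simp only [B, Matrix.of_apply]
      rw [inclProb_eq_zero (by omega) (by omega), inclProb_eq_zero (by omega) (by omega), sub_self]
    rw [Matrix.det_of_isUpperTriangular htri]
    refine Finset.prod_ne_zero_iff.2 fun s _ => ?_
    simp only [B, Matrix.of_apply]
    rw [inclProb_eq_zero (Nat.lt_succ_self _) (by omega), sub_zero]
    exact inclProb_self_ne_zero (by omega)
  have hpow (n : ℕ) (t : ℝ) : HasDerivAt (fun t : ℝ => t ^ (n + 1) / (n + 1)) (t ^ n) t := by
    refine ((hasDerivAt_pow (n + 1) t).div_const ((n : ℝ) + 1)).congr_deriv ?_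
    push_cast
    field_simp
  obtain ⟨F, hF0, hF⟩ := exists_potential w (fun s a => B s a) hD _ _
    (fun s t => (hpow (dv - 2 + 1) t).const_mul (∑ k, pcirc m ε k * inclProb m (s + 1) k))
    (fFun m dv ε) fun s y => sum_mul_fFun dv ε s y
  obtain ⟨G, hG0, hG⟩ := exists_potential (fun s => -v s)
    (fun s a => inclProb m (a + 1) s - inclProb m a s) hDC _ _
    (fun s t => ((hpow (dc - 2 + 1) (1 + t)).comp_const_add 1 t).sub (hasDerivAt_id t))
    (gFun m dc) fun s x => sum_mul_gFun dc s x
  refine ⟨D, F, G, ?_, fun a b => ?_, ?_, hF0, hG0, hF, hG⟩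
  · ext a b
    rw [Matrix.transpose_apply, hD, hD]
    exact Finset.sum_congr rfl fun s _ => by ring
  · rw [hDV]
    exact finrank_mixed_difference_pos a.2 b.2
  · simp only [D, Matrix.det_mul, Matrix.det_transpose, Matrix.det_diagonal]
    exact mul_ne_zero (mul_ne_zero hB (Finset.prod_ne_zero_iff.2 fun s _ => hw s)) hB

end
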